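/- Let E be a directed graph with isolated loops, and let G be a finite subset of E^0 ∪ E^1 (with G^0 = G ∩ E^0 containing r(G^1)). Then the graph E_G also has isolated loops. -/

import Mathlib

open Classical

variable {V : Type*} {E : Type*}

/-- Reflexive-transitive reachability along edges of a directed graph `(V, E, src, rng)`. -/
def Reach (src rng : E → V) : V → V → Prop :=
  Relation.ReflTransGen (fun a b => ∃ e, src e = a ∧ rng e = b)

/-- A loop in a directed graph: a nonempty list of edges, cyclically composable. -/
def IsLoop (src rng : E → V) (p : List E) : Prop :=
  p ≠ [] ∧ ∀ i : Fin p.length,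
    rng (p.get i) = src (p.get ⟨((i : ℕ) + 1) % p.length, Nat.mod_lt _ i.pos⟩)

/-- A loop is vertex-simple if the sources of its edges are pairwise distinct. -/
def VertexSimple (src : E → V) (p : List E) : Prop :=
  ∀ i j : Fin p.length, i ≠ j → src (p.get i) ≠ src (p.get j)

/-- A graph has isolated loops if any two loops passing through a common vertex
share the edge at that vertex. -/
def HasIsolatedLoops (src rng : E → V) : Prop :=
  ∀ p q : List E, IsLoop src rng p → IsLoop src rng q →
    ∀ (i : Fin p.length) (j : Fin q.length),
      src (p.get i) = src (q.get j) → p.get i = q.get j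

/-- An infinite path: a sequence of composable edges. -/
def IsInfPath (src rng : E → V) (b : ℕ → E) : Prop :=
  ∀ i, rng (b i) = src (b (i + 1))

/-- Shift-tail equivalence of infinite paths. -/
def ShiftTailEquiv (b c : ℕ → E) : Prop :=
  ∃ k m : ℕ, ∀ i : ℕ, b (k + i) = c (m + i)

/-- A maximal tail: nonempty, and satisfying (MT1), (MT2), (MT3). -/
def MaximalTail (src rng : E → V) (M : Set V) : Prop :=
  M.Nonempty ∧
  (∀ v w, w ∈ M → Reach src rng v w → v ∈ M) ∧
  (∀ v ∈ M, {e | src e = v}.Finite → {e | src e = v}.Nonempty →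
    ∃ e, src e = v ∧ rng e ∈ M) ∧
  (∀ v ∈ M, ∀ w ∈ M, ∃ y ∈ M, Reach src rng v y ∧ Reach src rng w y)

/-- A hereditary set of vertices. -/
def Hereditary (src rng : E → V) (X : Set V) : Prop :=
  ∀ e, src e ∈ X → rng e ∈ X

/-- A saturated set of vertices. -/
def Saturated (src rng : E → V) (X : Set V) : Prop :=
  ∀ v, {e | src e = v}.Finite → {e | src e = v}.Nonempty →
    (∀ e, src e = v → rng e ∈ X) → v ∈ X

/-- `LoopGE p q`: there is a path from a vertex of loop `p` to a vertex of loop `q`. -/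
def LoopGE (src rng : E → V) (p q : List E) : Prop :=
  ∃ (i : Fin p.length) (j : Fin q.length),
    Reach src rng (src (p.get i)) (src (q.get j))

/-- The vertex set of the graph `E_G`: edges in `G¹`, together with vertices of `G⁰`
that are sinks of `E` or emit an edge outside `G¹`. -/
def EGVertSet (src : E → V) (G1 : Set E) (G0 : Set V) : Set (E ⊕ V) :=
  {x | match x with
    | Sum.inl e => e ∈ G1
    | Sum.inr v => v ∈ G0 ∧ ((∀ e, src e ≠ v) ∨ ∃ e, e ∉ G1 ∧ src e = v)}

/-- The vertex of `E` attached to a vertex of `E_G`. -/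
def vertexOf (src : E → V) : E ⊕ V → V
  | Sum.inl e => src e
  | Sum.inr v => v

/-- Edges of `E_G`: pairs `(e, f)` with `e ∈ G¹`, `f` a vertex of `E_G`, and `r(e) = s(f)`. -/
def EGEdge (src rng : E → V) (G1 : Set E) (G0 : Set V) : Type _ :=
  {x : E × (E ⊕ V) // x.1 ∈ G1 ∧ x.2 ∈ EGVertSet src G1 G0 ∧ rng x.1 = vertexOf src x.2}

/-- Source map of `E_G`. -/
def EGsrc (src rng : E → V) (G1 : Set E) (G0 : Set V) :
    EGEdge src rng G1 G0 → E ⊕ V := fun x => Sum.inl x.1.1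

/-- Range map of `E_G`. -/
def EGrng (src rng : E → V) (G1 : Set E) (G0 : Set V) :
    EGEdge src rng G1 G0 → E ⊕ V := fun x => x.1.2

/-- The range of the `i`-th edge of a loop in `E_G` is the first component of the next edge. -/
theorem IsLoop.EGrng_get {src rng : E → V} {G1 : Set E} {G0 : Set V}
    {p : List (EGEdge src rng G1 G0)}
    (hp : IsLoop (EGsrc src rng G1 G0) (EGrng src rng G1 G0) p) (i : Fin p.length) :
    (p.get i).1.2 =
      Sum.inl (p.get ⟨((i : ℕ) + 1) % p.length, Nat.mod_lt _ i.pos⟩).1.1 :=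
  hp.2 i

/-- Taking first components turns a loop in `E_G` into a loop in `E`. -/
theorem IsLoop.map_fst {src rng : E → V} {G1 : Set E} {G0 : Set V}
    {p : List (EGEdge src rng G1 G0)}
    (hp : IsLoop (EGsrc src rng G1 G0) (EGrng src rng G1 G0) p) :
    IsLoop src rng (p.map fun x => x.1.1) := by
  refine ⟨by simpa using hp.1, fun i => ?_⟩
  have hi : (i : ℕ) < p.length := by simpa using i.2
  have h := (p.get ⟨i, hi⟩).2.2.2
  rw [hp.EGrng_get ⟨i, hi⟩] at h
  simpa [vertexOf] using h

/-- If `E` has isolated loops, then two loops in `E_G` whose edges at given positions have first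
components with the same source have the same first components there. -/
theorem HasIsolatedLoops.fst_get_eq {src rng : E → V} {G1 : Set E} {G0 : Set V}
    (hE : HasIsolatedLoops src rng) {p q : List (EGEdge src rng G1 G0)}
    (hp : IsLoop (EGsrc src rng G1 G0) (EGrng src rng G1 G0) p)
    (hq : IsLoop (EGsrc src rng G1 G0) (EGrng src rng G1 G0) q)
    (i : Fin p.length) (j : Fin q.length)
    (h : src (p.get i).1.1 = src (q.get j).1.1) : (p.get i).1.1 = (q.get j).1.1 := by
  have key := hE _ _ hp.map_fst hq.map_fst
    ⟨i, by simp⟩ ⟨j, by simp⟩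
  simp only [List.get_eq_getElem, List.getElem_map] at key h ⊢
  exact key h

/-- If `E` has isolated loops, then so does `E_G`. -/
theorem stmt_1 (src rng : E → V) (G1 : Set E) (G0 : Set V)
    (hG1 : G1.Finite) (hG0 : G0.Finite) (hr : ∀ e ∈ G1, rng e ∈ G0)
    (hE : HasIsolatedLoops src rng) :
    HasIsolatedLoops (EGsrc src rng G1 G0) (EGrng src rng G1 G0) := by
  intro p q hp hq i j hij
  have h1 : (p.get i).1.1 = (q.get j).1.1 := Sum.inl.inj hij
  refine Subtype.ext (Prod.ext h1 ?_)
  have hpr := (p.get i).2.2.2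
  have hqr := (q.get j).2.2.2
  rw [hp.EGrng_get i] at hpr ⊢
  rw [hq.EGrng_get j] at hqr ⊢
  refine congrArg Sum.inl (hE.fst_get_eq hp hq _ _ ?_)
  exact hpr.symm.trans ((congrArg rng h1).trans hqr)
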